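/- Every nonempty open interval I contained in (-1,0) contains a real number q₀ such that Rel(G;q₀) = 0 for some finite connected simple graph G. -/

import Mathlib

open SimpleGraph Finset

noncomputable section

/-- The finset of edges of a simple graph on a finite vertex type. -/
def edgeFin {V : Type} [Finite V] (G : SimpleGraph V) : Finset (Sym2 V) :=
  (Set.toFinite G.edgeSet).toFinset

open Classical in
/-- All-terminal reliability polynomial: `relPoly G q` is the probability that the graph stays
connected when every edge fails independently with probability `q`. -/
def relPoly {V : Type} [Finite V] (G : SimpleGraph V) (q : ℝ) : ℝ :=
  ∑ A ∈ (edgeFin G).powerset,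
    if (SimpleGraph.fromEdgeSet (A : Set (Sym2 V))).Connected then
      (1 - q) ^ A.card * q ^ ((edgeFin G).card - A.card) else 0

open Classical in
/-- Split reliability polynomial with terminals `u`, `v`: the sum is over edge subsets whose
spanning subgraph has exactly two components, one containing `u` and the other containing `v`. -/
def splitRel {V : Type} [Finite V] (H : SimpleGraph V) (u v : V) (q : ℝ) : ℝ :=
  ∑ A ∈ (edgeFin H).powerset,
    if (¬ (SimpleGraph.fromEdgeSet (A : Set (Sym2 V))).Reachable u v ∧
        ∀ w, (SimpleGraph.fromEdgeSet (A : Set (Sym2 V))).Reachable u w ∨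
             (SimpleGraph.fromEdgeSet (A : Set (Sym2 V))).Reachable v w) then
      (1 - q) ^ A.card * q ^ ((edgeFin H).card - A.card) else 0

/-- The virtual edge interaction `ŷ_H = Rel(H)/S(H) + 1`. -/
def yhat {V : Type} [Finite V] (H : SimpleGraph V) (u v : V) (q : ℝ) : ℝ :=
  relPoly H q / splitRel H u v q + 1

section Weights

variable {α ι : Type*}

open Classical in
/-- The real-valued indicator of a proposition. -/
def ind (p : Prop) : ℝ := if p then 1 else 0

lemma ind_true {p : Prop} (h : p) : ind p = 1 := if_pos h

lemma ind_false {p : Prop} (h : ¬ p) : ind p = 0 := if_neg h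

lemma ind_congr {p r : Prop} (h : p ↔ r) : ind p = ind r := by
  rw [propext h]

lemma ind_and (p r : Prop) : ind (p ∧ r) = ind p * ind r := by
  unfold ind; split_ifs <;> simp_all

lemma prod_ind (s : Finset ι) (p : ι → Prop) :
    ∏ i ∈ s, ind (p i) = ind (∀ i ∈ s, p i) := by
  classical
  induction s using Finset.induction_on with
  | empty => simp [ind]
  | insert i s hi ih => rw [Finset.prod_insert hi, ih, ← ind_and]; simp

/-- The weight of the set `A` of operational edges among all edges `E`. -/
def wt (q : ℝ) (E A : Finset α) : ℝ := (1 - q) ^ #A * q ^ (#E - #A)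

/-- The total weight of the edge subsets of `E`, weighted further by `f`. -/
def wsum (q : ℝ) (E : Finset α) (f : Finset α → ℝ) : ℝ :=
  ∑ A ∈ E.powerset, f A * wt q E A

lemma wsum_congr (q : ℝ) {E : Finset α} {f g : Finset α → ℝ} (h : ∀ A ⊆ E, f A = g A) :
    wsum q E f = wsum q E g :=
  Finset.sum_congr rfl fun A hA => by rw [h A (Finset.mem_powerset.1 hA)]

lemma wsum_sum (q : ℝ) (E : Finset α) (s : Finset ι) (f : ι → Finset α → ℝ) :
    wsum q E (fun A => ∑ i ∈ s, f i A) = ∑ i ∈ s, wsum q E (f i) := by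
  simp only [wsum, Finset.sum_mul]
  rw [Finset.sum_comm]

lemma wsum_add (q : ℝ) (E : Finset α) (f g : Finset α → ℝ) :
    wsum q E (fun A => f A + g A) = wsum q E f + wsum q E g := by
  simp only [wsum, add_mul, Finset.sum_add_distrib]

lemma wsum_one (q : ℝ) (E : Finset α) : wsum q E (fun _ => 1) = 1 := by
  have := Finset.sum_pow_mul_eq_add_pow (1 - q) q E
  simpa [wsum, wt] using this

lemma wsum_ind_empty (q : ℝ) (E : Finset α) : wsum q E (fun A => ind (A = ∅)) = q ^ #E := by
  rw [wsum, Finset.sum_eq_single ∅]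
  · simp [ind, wt]
  · intro A _ hA
    simp [ind, hA]
  · simp

variable [DecidableEq α]

/-- Weighted sums factor over disjoint edge sets. -/
lemma wsum_union (q : ℝ) {E₁ E₂ : Finset α} (h : Disjoint E₁ E₂) (f g : Finset α → ℝ) :
    wsum q (E₁ ∪ E₂) (fun A => f (A ∩ E₁) * g (A ∩ E₂)) = wsum q E₁ f * wsum q E₂ g := by
  simp only [wsum, Finset.sum_mul_sum, ← Finset.sum_product']
  refine Finset.sum_bij' (fun A _ => (A ∩ E₁, A ∩ E₂)) (fun p _ => p.1 ∪ p.2) ?_ ?_ ?_ ?_ ?_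
  · intro A _
    simp
  · intro p hp
    simp only [Finset.mem_product, Finset.mem_powerset] at hp ⊢
    exact Finset.union_subset_union hp.1 hp.2
  · intro A hA
    rw [Finset.mem_powerset] at hA
    rw [← Finset.inter_union_distrib_left, Finset.inter_eq_left.2 hA]
  · rintro ⟨A, B⟩ hp
    simp only [Finset.mem_product, Finset.mem_powerset] at hp
    obtain ⟨hA, hB⟩ := hp
    ext x
    · have hx := Finset.disjoint_left.1 h
      have hx := @hx x
      have h₁ := @hA x
      have h₂ := @hB x
      simp only [Finset.mem_inter, Finset.mem_union]
      tauto
    · have hx := Finset.disjoint_left.1 h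
      have hx := @hx x
      have h₁ := @hA x
      have h₂ := @hB x
      simp only [Finset.mem_inter, Finset.mem_union]
      tauto
  · intro A hA
    rw [Finset.mem_powerset] at hA
    have hcard : #A = #(A ∩ E₁) + #(A ∩ E₂) := by
      rw [← Finset.card_union_of_disjoint
        (h.mono Finset.inter_subset_right Finset.inter_subset_right),
        ← Finset.inter_union_distrib_left, Finset.inter_eq_left.2 hA]
    have h₁ : #(A ∩ E₁) ≤ #E₁ := Finset.card_le_card Finset.inter_subset_right
    have h₂ : #(A ∩ E₂) ≤ #E₂ := Finset.card_le_card Finset.inter_subset_right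
    have hsub : #(E₁ ∪ E₂) - #A = (#E₁ - #(A ∩ E₁)) + (#E₂ - #(A ∩ E₂)) := by
      rw [Finset.card_union_of_disjoint h]
      omega
    simp only [wt]
    rw [hsub, hcard, pow_add, pow_add]
    ring

lemma wsum_biUnion [DecidableEq ι] (q : ℝ) (s : Finset ι) (E : ι → Finset α)
    (h : ∀ i ∈ s, ∀ j ∈ s, i ≠ j → Disjoint (E i) (E j)) (f : ι → Finset α → ℝ) :
    wsum q (s.biUnion E) (fun A => ∏ i ∈ s, f i (A ∩ E i)) = ∏ i ∈ s, wsum q (E i) (f i) := by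
  induction s using Finset.induction_on with
  | empty => simp [wsum, wt]
  | insert i s hi ih =>
    have hd : Disjoint (E i) (s.biUnion E) := by
      rw [Finset.disjoint_biUnion_right]
      intro j hj
      exact h i (Finset.mem_insert_self _ _) j (Finset.mem_insert_of_mem hj)
        (by rintro rfl; exact hi hj)
    rw [Finset.prod_insert hi, ← ih fun j hj k hk =>
        h j (Finset.mem_insert_of_mem hj) k (Finset.mem_insert_of_mem hk),
      ← wsum_union q hd, Finset.biUnion_insert]
    refine wsum_congr q fun A _ => ?_
    rw [Finset.prod_insert hi]
    congr 1
    refine Finset.prod_congr rfl fun j hj => ?_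
    rw [Finset.inter_assoc, Finset.inter_eq_right.2 (Finset.subset_biUnion_of_mem E hj)]

end Weights
section Cliques

variable {V : Type}

/-- `x` and `y` are joined by a path of edges in `A`. -/
def EdgeJoined (A : Finset (Sym2 V)) (x y : V) : Prop :=
  (SimpleGraph.fromEdgeSet (A : Set (Sym2 V))).Reachable x y

lemma EdgeJoined.refl {A : Finset (Sym2 V)} (x : V) : EdgeJoined A x x := SimpleGraph.Reachable.refl x

lemma EdgeJoined.symm {A : Finset (Sym2 V)} {x y : V} (h : EdgeJoined A x y) : EdgeJoined A y x :=
  SimpleGraph.Reachable.symm h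

lemma EdgeJoined.trans {A : Finset (Sym2 V)} {x y z : V} (h : EdgeJoined A x y) (h' : EdgeJoined A y z) :
    EdgeJoined A x z :=
  SimpleGraph.Reachable.trans h h'

lemma EdgeJoined.mono {A B : Finset (Sym2 V)} {x y : V} (hAB : A ⊆ B) (h : EdgeJoined A x y) :
    EdgeJoined B x y :=
  SimpleGraph.Reachable.mono (SimpleGraph.fromEdgeSet_mono (by exact_mod_cast hAB)) h

lemma EdgeJoined.of_mem {A : Finset (Sym2 V)} {x y : V} (h : s(x, y) ∈ A) : EdgeJoined A x y := by
  by_cases hxy : x = y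
  · subst hxy
    exact .refl x
  · exact SimpleGraph.Adj.reachable ((SimpleGraph.fromEdgeSet_adj _).2 ⟨by exact_mod_cast h, hxy⟩)

lemma EdgeJoined.induction {A : Finset (Sym2 V)} {x y : V} (h : EdgeJoined A x y) {P : V → Prop}
    (base : P x) (step : ∀ a b, EdgeJoined A x a → P a → s(a, b) ∈ A → P b) : P y := by
  have h' := (SimpleGraph.reachable_iff_reflTransGen _ _).1 h
  suffices EdgeJoined A x y ∧ P y from this.2
  induction h' with
  | refl => exact ⟨.refl x, base⟩
  | @tail b c hab hbc ih =>
    have hmem : s(b, c) ∈ A := by exact_mod_cast ((SimpleGraph.fromEdgeSet_adj _).1 hbc).1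
    obtain ⟨h1, h2⟩ := ih ((SimpleGraph.reachable_iff_reflTransGen _ _).2 hab)
    exact ⟨h1.trans (.of_mem hmem), step _ _ h1 h2 hmem⟩

/-- All vertices of `W` are joined to each other by edges in `A`. -/
def Linked (A : Finset (Sym2 V)) (W : Finset V) : Prop := ∀ x ∈ W, ∀ y ∈ W, EdgeJoined A x y

/-- The edge set `A` splits `W` into a component of `u` and a different component of `v`. -/
def Splits (A : Finset (Sym2 V)) (W : Finset V) (u v : V) : Prop :=
  ¬ EdgeJoined A u v ∧ ∀ w ∈ W, EdgeJoined A u w ∨ EdgeJoined A v w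

/-- Among the vertices in `W`, exactly those in `U` are joined to `r`. -/
def IsComp (A : Finset (Sym2 V)) (W U : Finset V) (r : V) : Prop :=
  ∀ x ∈ W, EdgeJoined A r x ↔ x ∈ U

variable [DecidableEq V]

/-- The pairs of distinct elements of `W`. -/
def pairs (W : Finset V) : Finset (Sym2 V) := {e ∈ W.sym2 | ¬ e.IsDiag}

lemma mk_mem_pairs {W : Finset V} {x y : V} : s(x, y) ∈ pairs W ↔ x ∈ W ∧ y ∈ W ∧ x ≠ y := by
  simp [pairs, and_assoc]

lemma card_pairs (W : Finset V) : #(pairs W) = (#W).choose 2 := by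
  rw [← Sym2.card_image_offDiag]
  congr 1
  ext e
  induction e with | _ x y
  rw [mk_mem_pairs]
  simp only [Finset.mem_image, Finset.mem_offDiag, Prod.exists]
  constructor
  · exact fun h => ⟨x, y, h, rfl⟩
  · rintro ⟨a, b, ⟨h1, h2, h3⟩, h⟩
    obtain ⟨rfl, rfl⟩ | ⟨rfl, rfl⟩ := Sym2.eq_iff.1 h
    · exact ⟨h1, h2, h3⟩
    · exact ⟨h2, h1, h3.symm⟩

lemma pairs_mono {U W : Finset V} (h : U ⊆ W) : pairs U ⊆ pairs W := by
  intro e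
  induction e with | _ x y
  simp only [mk_mem_pairs]
  exact fun ⟨h1, h2, h3⟩ => ⟨h h1, h h2, h3⟩

/-- The pairs joining `U` to its complement in `W`. -/
def crossPairs (W U : Finset V) : Finset (Sym2 V) := pairs W \ (pairs U ∪ pairs (W \ U))

lemma disjoint_pairs {U W : Finset V} (h : Disjoint U W) : Disjoint (pairs U) (pairs W) := by
  rw [Finset.disjoint_left]
  intro e
  induction e with | _ x y
  simp only [mk_mem_pairs]
  exact fun h1 h2 => Finset.disjoint_left.1 h h1.1 h2.1

lemma add_choose_two (a b : ℕ) : (a + b).choose 2 = a.choose 2 + b.choose 2 + a * b := by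
  induction b with
  | zero => simp
  | succ b ih =>
    rw [← add_assoc, Nat.choose_succ_succ' _ 1, ih, Nat.choose_succ_succ' b 1,
      Nat.choose_one_right, Nat.choose_one_right]
    ring

lemma card_crossPairs {U W : Finset V} (h : U ⊆ W) :
    #(crossPairs W U) = #U * #(W \ U) := by
  have hsub : pairs U ∪ pairs (W \ U) ⊆ pairs W :=
    Finset.union_subset (pairs_mono h) (pairs_mono Finset.sdiff_subset)
  rw [crossPairs, Finset.card_sdiff_of_subset hsub,
    Finset.card_union_of_disjoint (disjoint_pairs Finset.disjoint_sdiff),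
    card_pairs, card_pairs, card_pairs, ← Finset.card_sdiff_add_card_eq_card h,
    add_comm #(W \ U), add_choose_two]
  omega

lemma pairs_eq_union {U W : Finset V} (h : U ⊆ W) :
    pairs W = pairs U ∪ (crossPairs W U ∪ pairs (W \ U)) := by
  have h1 := pairs_mono h
  have h2 := pairs_mono (Finset.sdiff_subset : W \ U ⊆ W)
  ext e
  have h1 := @h1 e
  have h2 := @h2 e
  simp only [crossPairs, Finset.mem_union, Finset.mem_sdiff]
  tauto

lemma isComp_iff {A : Finset (Sym2 V)} {W U : Finset V} {r : V} (hA : A ⊆ pairs W)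
    (hU : U ⊆ W) (hr : r ∈ U) :
    IsComp A W U r ↔ Linked (A ∩ pairs U) U ∧ A ∩ crossPairs W U = ∅ := by
  constructor
  · intro h
    have key : ∀ x, EdgeJoined A r x → x ∈ U ∧ EdgeJoined (A ∩ pairs U) r x := by
      intro x hx
      refine hx.induction (P := fun x => x ∈ U ∧ EdgeJoined (A ∩ pairs U) r x) ⟨hr, .refl r⟩ fun a b hra ⟨haU, ha⟩ hab => ?_
      obtain ⟨-, hbW, hne⟩ := mk_mem_pairs.1 (hA hab)
      have hbU : b ∈ U := (h b hbW).1 (hra.trans (.of_mem hab))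
      exact ⟨hbU, ha.trans (.of_mem (Finset.mem_inter.2 ⟨hab, mk_mem_pairs.2 ⟨haU, hbU, hne⟩⟩))⟩
    refine ⟨fun x hx y hy => ?_, Finset.eq_empty_of_forall_notMem fun e => ?_⟩
    · exact (key x ((h x (hU hx)).2 hx)).2.symm.trans (key y ((h y (hU hy)).2 hy)).2
    · induction e with | _ a b
      simp only [crossPairs, Finset.mem_inter, Finset.mem_sdiff, Finset.mem_union, mk_mem_pairs]
      rintro ⟨hab, ⟨haW, hbW, hne⟩, hn⟩
      have : a ∈ U ↔ b ∈ U := by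
        rw [← h a haW, ← h b hbW]
        exact ⟨fun h => h.trans (.of_mem hab), fun h => h.trans (EdgeJoined.of_mem hab).symm⟩
      tauto
  · rintro ⟨h1, h2⟩ x hx
    constructor
    · intro hrx
      refine hrx.induction hr fun a b _ haU hab => ?_
      by_contra hbU
      have : s(a, b) ∈ A ∩ crossPairs W U := by
        simp only [crossPairs, Finset.mem_inter, Finset.mem_sdiff, Finset.mem_union, mk_mem_pairs]
        have := mk_mem_pairs.1 (hA hab)
        tauto
      simp [h2] at this
    · exact fun hxU => (h1 r hr x hxU).mono Finset.inter_subset_left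

lemma crossPairs_sdiff {U W : Finset V} (hU : U ⊆ W) : crossPairs W (W \ U) = crossPairs W U := by
  rw [crossPairs, crossPairs, Finset.sdiff_sdiff_eq_self hU, Finset.union_comm]

lemma wsum_pairs_eq (q : ℝ) {U W : Finset V} (hU : U ⊆ W) (f g : Finset (Sym2 V) → ℝ) :
    wsum q (pairs W) (fun A => f (A ∩ pairs U) * (ind (A ∩ crossPairs W U = ∅) *
      g (A ∩ pairs (W \ U)))) =
      wsum q (pairs U) f * (q ^ (#U * #(W \ U)) * wsum q (pairs (W \ U)) g) := by
  have h2 : Disjoint (crossPairs W U) (pairs (W \ U)) :=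
    Finset.sdiff_disjoint.mono_right Finset.subset_union_right
  have h1 : Disjoint (pairs U) (crossPairs W U ∪ pairs (W \ U)) :=
    Finset.disjoint_union_right.2
      ⟨Finset.disjoint_sdiff.mono_left Finset.subset_union_left,
        disjoint_pairs Finset.disjoint_sdiff⟩
  rw [← card_crossPairs hU, ← wsum_ind_empty, ← wsum_union q h2, ← wsum_union q h1,
    ← pairs_eq_union hU]
  refine wsum_congr q fun A _ => ?_
  simp only [Finset.inter_assoc]
  rw [Finset.inter_eq_right.2 Finset.subset_union_left,
    Finset.inter_eq_right.2 Finset.subset_union_right]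

/-- Reliability of the complete graph on `W`. -/
def cliqueRel (q : ℝ) (W : Finset V) : ℝ := wsum q (pairs W) fun A => ind (Linked A W)

/-- Split reliability of the complete graph on `W`. -/
def cliqueSplit (q : ℝ) (W : Finset V) (u v : V) : ℝ :=
  wsum q (pairs W) fun A => ind (Splits A W u v)

lemma wsum_isComp (q : ℝ) {U W : Finset V} {r : V} (hU : U ⊆ W) (hr : r ∈ U) :
    wsum q (pairs W) (fun A => ind (IsComp A W U r)) =
      cliqueRel q U * q ^ (#U * #(W \ U)) := by
  have := wsum_pairs_eq q hU (fun A => ind (Linked A U)) (fun _ => 1)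
  rw [wsum_one, mul_one] at this
  rw [cliqueRel, ← this]
  refine wsum_congr q fun A hA => ?_
  rw [isComp_iff hA hU hr, ind_and, mul_one]

lemma wsum_isComp_and (q : ℝ) {U W : Finset V} {u v : V} (hU : U ⊆ W) (hu : u ∈ U)
    (hv : v ∈ W \ U) :
    wsum q (pairs W) (fun A => ind (IsComp A W U u ∧ IsComp A W (W \ U) v)) =
      cliqueRel q U * cliqueRel q (W \ U) * q ^ (#U * #(W \ U)) := by
  have := wsum_pairs_eq q hU (fun A => ind (Linked A U)) (fun A => ind (Linked A (W \ U)))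
  rw [cliqueRel, cliqueRel, mul_assoc, mul_comm (wsum q (pairs (W \ U)) _), ← this]
  refine wsum_congr q fun A hA => ?_
  rw [isComp_iff hA hU hu, isComp_iff hA Finset.sdiff_subset hv, crossPairs_sdiff hU,
    ← ind_and, ← ind_and]
  exact ind_congr (by tauto)

open Classical in
lemma sum_cliqueRel (q : ℝ) {W : Finset V} {r : V} (hr : r ∈ W) :
    ∑ U ∈ (W.erase r).powerset,
      cliqueRel q (insert r U) * q ^ (#(insert r U) * #(W \ insert r U)) = 1 := by
  have hsub : ∀ U ∈ (W.erase r).powerset, insert r U ⊆ W := fun U hU =>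
    Finset.insert_subset hr ((Finset.mem_powerset.1 hU).trans (Finset.erase_subset _ _))
  rw [← wsum_one q (pairs W), Finset.sum_congr rfl fun U hU =>
    (wsum_isComp q (hsub U hU) (Finset.mem_insert_self r U)).symm, ← wsum_sum]
  refine wsum_congr q fun A _ => ?_
  rw [Finset.sum_eq_single {x ∈ W.erase r | EdgeJoined A r x}]
  · refine ind_true fun x hx => ?_
    by_cases hxr : x = r
    · simp [hxr, EdgeJoined.refl]
    · simp [hxr, hx]
  · intro U hU hne
    refine ind_false fun h => hne ?_
    ext x
    have h' := h x
    have hU' := Finset.mem_powerset.1 hU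
    have hxU := @hU' x
    simp only [Finset.mem_insert, Finset.mem_filter, Finset.mem_erase] at *
    tauto
  · intro h
    simp at h

open Classical in
lemma cliqueSplit_eq_sum (q : ℝ) {W : Finset V} {u v : V} (hu : u ∈ W) (hv : v ∈ W)
    (huv : u ≠ v) :
    cliqueSplit q W u v = ∑ U ∈ ((W.erase u).erase v).powerset,
      cliqueRel q (insert u U) * cliqueRel q (W \ insert u U) *
        q ^ (#(insert u U) * #(W \ insert u U)) := by
  have hsub : ∀ U ∈ ((W.erase u).erase v).powerset, insert u U ⊆ W := fun U hU =>
    Finset.insert_subset hu ((Finset.mem_powerset.1 hU).trans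
      ((Finset.erase_subset _ _).trans (Finset.erase_subset _ _)))
  have hvU : ∀ U ∈ ((W.erase u).erase v).powerset, v ∈ W \ insert u U := fun U hU => by
    have hU' := Finset.mem_powerset.1 hU
    have hU' := @hU' v
    simp only [Finset.mem_sdiff, Finset.mem_insert, Finset.mem_erase] at *
    tauto
  rw [Finset.sum_congr rfl fun U hU =>
    (wsum_isComp_and q (hsub U hU) (Finset.mem_insert_self u U) (hvU U hU)).symm, ← wsum_sum]
  refine wsum_congr q fun A _ => ?_
  by_cases hS : Splits A W u v
  · rw [ind_true hS, Finset.sum_eq_single {x ∈ (W.erase u).erase v | EdgeJoined A u x}]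
    · refine (ind_true ?_).symm
      have h1 : IsComp A W (insert u {x ∈ (W.erase u).erase v | EdgeJoined A u x}) u := by
        intro x hx
        by_cases hxr : x = u
        · simp [hxr, EdgeJoined.refl]
        · by_cases hxv : x = v
          · simp [hxv, huv.symm, hS.1]
          · simp [hxr, hx, hxv]
      refine ⟨h1, fun x hx => ?_⟩
      rw [Finset.mem_sdiff, ← h1 x hx]
      refine ⟨fun h => ⟨hx, fun h' => hS.1 (h'.trans h.symm)⟩, fun h => ?_⟩
      exact (hS.2 x hx).resolve_left h.2
    · intro U hU hne
      refine ind_false fun h => hne ?_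
      ext x
      have h' := h.1 x
      have hU' := Finset.mem_powerset.1 hU
      have hxU := @hU' x
      have hv' := hS.1
      by_cases hxv : x = v
      · simp only [Finset.mem_filter, Finset.mem_erase] at *
        tauto
      · simp only [Finset.mem_insert, Finset.mem_filter, Finset.mem_erase] at *
        tauto
    · intro h
      simp at h
  · rw [ind_false hS, Finset.sum_eq_zero]
    intro U hU
    refine ind_false fun h => hS ⟨fun h' => ?_, fun w hw => ?_⟩
    · have h3 := (h.1 v hv).1 h'
      have := hvU U hU
      simp_all
    · rw [h.1 w hw, h.2 w hw]
      by_cases hwU : w ∈ insert u U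
      · exact .inl hwU
      · exact .inr (Finset.mem_sdiff.2 ⟨hw, hwU⟩)

end Cliques
section Recursion

/-- The reliability of the complete graph on `m + 1` vertices, defined recursively. -/
def relSeq (q : ℝ) : ℕ → ℝ
  | m => 1 - ∑ k : Fin m, (m.choose k : ℝ) * (relSeq q k * q ^ ((k.1 + 1) * (m - k)))

lemma relSeq_eq (q : ℝ) (m : ℕ) :
    relSeq q m =
      1 - ∑ k ∈ Finset.range m, (m.choose k : ℝ) * (relSeq q k * q ^ ((k + 1) * (m - k))) := by
  rw [relSeq, Finset.sum_range]

/-- The split reliability of the complete graph on `m + 2` vertices, without the factor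
`q ^ (m + 1)`. -/
def splitSeq (q : ℝ) (m : ℕ) : ℝ :=
  ∑ k ∈ Finset.range (m + 1), (m.choose k : ℝ) *
    (relSeq q k * relSeq q (m - k) * q ^ (k * (m - k)))

lemma continuous_relSeq (m : ℕ) : Continuous fun q => relSeq q m := by
  induction m using Nat.strong_induction_on with
  | _ m ih =>
    simp only [relSeq_eq _ m]
    refine continuous_const.sub (continuous_finsetSum _ fun k hk => ?_)
    have := ih k (Finset.mem_range.1 hk)
    fun_prop

lemma continuous_splitSeq (m : ℕ) : Continuous fun q => splitSeq q m := by
  unfold splitSeq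
  refine continuous_finsetSum _ fun k _ => ?_
  have h1 := continuous_relSeq k
  have h2 := continuous_relSeq (m - k)
  fun_prop

variable {V : Type} [DecidableEq V]

lemma cliqueRel_eq (q : ℝ) (m : ℕ) (W : Finset V) (hW : #W = m + 1) :
    cliqueRel q W = relSeq q m := by
  induction m using Nat.strong_induction_on generalizing W with
  | _ m ih =>
    obtain ⟨r, hr⟩ : W.Nonempty := Finset.card_pos.1 (by omega)
    have hcard : #(W.erase r) = m := by rw [Finset.card_erase_of_mem hr]; omega
    have hins : ∀ U ∈ (W.erase r).powerset, #(insert r U) = #U + 1 := fun U hU =>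
      Finset.card_insert_of_notMem fun h => by
        simpa using Finset.mem_powerset.1 hU h
    have hsd : ∀ U ∈ (W.erase r).powerset, #(W \ insert r U) = m - #U := fun U hU => by
      rw [Finset.card_sdiff_of_subset (Finset.insert_subset hr
        ((Finset.mem_powerset.1 hU).trans (Finset.erase_subset _ _))), hins U hU, hW]
      omega
    have h := sum_cliqueRel q hr
    have hterm : ∀ U ∈ (W.erase r).powerset,
        cliqueRel q (insert r U) * q ^ (#(insert r U) * #(W \ insert r U)) =
          (if #U = m then cliqueRel q W else relSeq q #U) * q ^ ((#U + 1) * (m - #U)) := by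
      intro U hU
      rw [hins U hU, hsd U hU]
      split_ifs with hm
      · rw [Finset.eq_of_subset_of_card_le (Finset.mem_powerset.1 hU) (by omega),
          Finset.insert_erase hr]
      · have := Finset.card_le_card (Finset.mem_powerset.1 hU)
        rw [ih #U (by omega) _ (hins U hU)]
    rw [Finset.sum_congr rfl hterm, Finset.sum_powerset_apply_card
      (fun k => (if k = m then cliqueRel q W else relSeq q k) * q ^ ((k + 1) * (m - k))),
      hcard, Finset.sum_range_succ] at h
    simp only [if_true, Nat.choose_self, Nat.sub_self, mul_zero, pow_zero, one_smul,
      mul_one] at h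
    rw [relSeq_eq, ← h, add_comm, eq_sub_iff_add_eq, add_right_inj]
    refine Finset.sum_congr rfl fun k hk => ?_
    rw [if_neg (Finset.mem_range.1 hk).ne, nsmul_eq_mul]

lemma cliqueSplit_eq (q : ℝ) (m : ℕ) (W : Finset V) (hW : #W = m + 2) {u v : V} (hu : u ∈ W)
    (hv : v ∈ W) (huv : u ≠ v) : cliqueSplit q W u v = q ^ (m + 1) * splitSeq q m := by
  have hcard : #((W.erase u).erase v) = m := by
    rw [Finset.card_erase_of_mem (Finset.mem_erase.2 ⟨huv.symm, hv⟩), Finset.card_erase_of_mem hu]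
    omega
  have hterm : ∀ U ∈ ((W.erase u).erase v).powerset,
      cliqueRel q (insert u U) * cliqueRel q (W \ insert u U) *
        q ^ (#(insert u U) * #(W \ insert u U)) =
      relSeq q #U * relSeq q (m - #U) * q ^ ((#U + 1) * (m - #U + 1)) := by
    intro U hU
    have hU' := Finset.mem_powerset.1 hU
    have hle := Finset.card_le_card hU'
    have h1 : #(insert u U) = #U + 1 := Finset.card_insert_of_notMem fun h => by
      simpa using hU' h
    have h2 : #(W \ insert u U) = m - #U + 1 := by
      rw [Finset.card_sdiff_of_subset (Finset.insert_subset hu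
        (hU'.trans ((Finset.erase_subset _ _).trans (Finset.erase_subset _ _)))), h1, hW]
      omega
    rw [cliqueRel_eq q _ _ h1, cliqueRel_eq q _ _ h2, h1, h2]
  rw [cliqueSplit_eq_sum q hu hv huv, Finset.sum_congr rfl hterm, Finset.sum_powerset_apply_card
    (fun k => relSeq q k * relSeq q (m - k) * q ^ ((k + 1) * (m - k + 1))), hcard, splitSeq,
    Finset.mul_sum]
  refine Finset.sum_congr rfl fun k hk => ?_
  obtain ⟨j, rfl⟩ := Nat.exists_eq_add_of_le (Nat.lt_succ_iff.1 (Finset.mem_range.1 hk))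
  rw [Nat.add_sub_cancel_left, nsmul_eq_mul]
  ring

end Recursion

section Asymptotics

/-- The middle part of the binomial sum with Gaussian weights. -/
def midSum (t : ℝ) (m : ℕ) : ℝ :=
  ∑ k ∈ Finset.Ico 1 m, (m.choose k : ℝ) * t ^ (k * (m - k))

lemma midSum_nonneg {t : ℝ} (ht : 0 ≤ t) (m : ℕ) : 0 ≤ midSum t m :=
  Finset.sum_nonneg fun _ _ => by positivity

lemma sum_Ico_choose_mul_pow_le {y : ℝ} (m : ℕ) (hy : 0 ≤ y) :
    ∑ k ∈ Finset.Ico 1 m, (m.choose k : ℝ) * y ^ k ≤ (1 + y) ^ m - 1 := by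
  have h := add_pow y 1 m
  rw [add_comm y 1, Finset.range_eq_Ico, Finset.sum_eq_sum_Ico_succ_bot (by omega)] at h
  have : ∑ k ∈ Finset.Ico 1 m, (m.choose k : ℝ) * y ^ k ≤
      ∑ k ∈ Finset.Ico (0 + 1) (m + 1), y ^ k * 1 ^ (m - k) * (m.choose k : ℝ) := by
    rw [zero_add]
    refine (Finset.sum_le_sum_of_subset_of_nonneg (Finset.Ico_subset_Ico_right (Nat.le_succ m))
      fun _ _ _ => by positivity).trans_eq (Finset.sum_congr rfl fun k _ => ?_)
    rw [one_pow, mul_one, mul_comm]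
  simp only [pow_zero, one_pow, Nat.choose_zero_right, Nat.cast_one, mul_one] at h this
  linarith

lemma midSum_sq_le {y : ℝ} (hy : 0 ≤ y) (hy1 : y ≤ 1) (m : ℕ) :
    midSum (y ^ 2) m ≤ 2 * ((1 + y ^ m) ^ m - 1) := by
  have hym : 0 ≤ y ^ m := by positivity
  have hle : midSum (y ^ 2) m ≤ ∑ k ∈ Finset.Ico 1 m, (m.choose k : ℝ) * (y ^ m) ^ k +
      ∑ k ∈ Finset.Ico 1 m, (m.choose k : ℝ) * (y ^ m) ^ (m - k) := by
    rw [midSum, ← Finset.sum_add_distrib]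
    refine Finset.sum_le_sum fun k hk => ?_
    obtain ⟨h1, h2⟩ := Finset.mem_Ico.1 hk
    obtain ⟨j, rfl⟩ := Nat.exists_eq_add_of_le h2.le
    rw [← mul_add, Nat.add_sub_cancel_left]
    refine mul_le_mul_of_nonneg_left ?_ (by positivity)
    rw [← pow_mul, ← pow_mul, ← pow_mul]
    rcases le_total k j with h | h
    · have : y ^ (2 * (k * j)) ≤ y ^ ((k + j) * k) :=
        pow_le_pow_of_le_one hy hy1 (by nlinarith)
      have : 0 ≤ y ^ ((k + j) * j) := by positivity
      linarith
    · have : y ^ (2 * (k * j)) ≤ y ^ ((k + j) * j) :=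
        pow_le_pow_of_le_one hy hy1 (by nlinarith)
      have : 0 ≤ y ^ ((k + j) * k) := by positivity
      linarith
  have hrefl : ∑ k ∈ Finset.Ico 1 m, (m.choose k : ℝ) * (y ^ m) ^ (m - k) =
      ∑ k ∈ Finset.Ico 1 m, (m.choose k : ℝ) * (y ^ m) ^ k := by
    refine Finset.sum_nbij' (m - ·) (m - ·) ?_ ?_ ?_ ?_ ?_
    · intro k hk; simp only [Finset.mem_Ico] at *; omega
    · intro k hk; simp only [Finset.mem_Ico] at *; omega
    · intro k hk; simp only [Finset.mem_Ico] at *; omega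
    · intro k hk; simp only [Finset.mem_Ico] at *; omega
    · intro k hk
      rw [Nat.choose_symm (Finset.mem_Ico.1 hk).2.le]
  have := sum_Ico_choose_mul_pow_le m hym
  linarith

lemma tendsto_midSum {t : ℝ} (ht : 0 ≤ t) (ht1 : t < 1) :
    Filter.Tendsto (midSum t) Filter.atTop (nhds 0) := by
  have hy : 0 ≤ √t := Real.sqrt_nonneg t
  have hy1 : √t < 1 := by rwa [Real.sqrt_lt' one_pos, one_pow]
  have h := tendsto_self_mul_const_pow_of_lt_one hy hy1
  have h' : Filter.Tendsto (fun m : ℕ => 2 * (Real.exp (m * √t ^ m) - 1)) Filter.atTop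
      (nhds 0) := by
    have := (((Real.continuous_exp.tendsto 0).comp h).sub_const 1).const_mul 2
    simpa using this
  refine squeeze_zero (midSum_nonneg ht) (fun m => ?_) h'
  have h1 := midSum_sq_le hy hy1.le m
  rw [Real.sq_sqrt ht] at h1
  have h2 : (1 + √t ^ m) ^ m ≤ Real.exp (m * √t ^ m) := by
    rw [Real.exp_nat_mul]
    refine pow_le_pow_left₀ (by positivity) ?_ m
    rw [add_comm]
    exact Real.add_one_le_exp _
  linarith

lemma abs_relSeq_sub_one_le (q : ℝ) (hq : |q| ≤ 1) {B : ℝ} (m : ℕ) (hm : 1 ≤ m)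
    (hB : ∀ k < m, |relSeq q k| ≤ B) :
    |relSeq q m - 1| ≤ B * (|q| ^ m + midSum |q| m) := by
  have hB0 : 0 ≤ B := (abs_nonneg _).trans (hB 0 (by omega))
  rw [relSeq_eq, sub_sub_cancel_left, abs_neg, Finset.range_eq_Ico,
    Finset.sum_eq_sum_Ico_succ_bot (by omega)]
  refine (abs_add_le _ _).trans ?_
  rw [mul_add, midSum, Finset.mul_sum]
  refine add_le_add ?_ ((Finset.abs_sum_le_sum_abs _ _).trans (Finset.sum_le_sum fun k hk => ?_))
  · rw [Nat.choose_zero_right, Nat.cast_one, one_mul, zero_add, one_mul, Nat.sub_zero, abs_mul,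
      abs_pow]
    exact mul_le_mul_of_nonneg_right (hB 0 (by omega)) (by positivity)
  · rw [abs_mul, abs_mul, abs_pow, Nat.abs_cast, mul_left_comm]
    have h1 := hB k (Finset.mem_Ico.1 hk).2
    have h2 : |q| ^ ((k + 1) * (m - k)) ≤ |q| ^ (k * (m - k)) :=
      pow_le_pow_of_le_one (abs_nonneg q) hq (Nat.mul_le_mul_right _ (by omega))
    gcongr

lemma tendsto_pow_add_midSum {t : ℝ} (ht : 0 ≤ t) (ht1 : t < 1) :
    Filter.Tendsto (fun m => t ^ m + midSum t m) Filter.atTop (nhds 0) := by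
  simpa using (tendsto_pow_atTop_nhds_zero_of_lt_one ht ht1).add (tendsto_midSum ht ht1)

lemma exists_abs_relSeq_le {q : ℝ} (hq : |q| < 1) : ∃ B, ∀ m, |relSeq q m| ≤ B := by
  have h := (tendsto_pow_add_midSum (abs_nonneg q) hq).eventually_le_const
    (show (0 : ℝ) < 1 / 2 by norm_num)
  obtain ⟨M, hM⟩ := Filter.eventually_atTop.1 h
  refine ⟨2 + ∑ k ∈ Finset.range (M + 1), |relSeq q k|, fun m => ?_⟩
  set B := 2 + ∑ k ∈ Finset.range (M + 1), |relSeq q k| with hBdef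
  have hS : 0 ≤ ∑ k ∈ Finset.range (M + 1), |relSeq q k| :=
    Finset.sum_nonneg fun _ _ => abs_nonneg _
  induction m using Nat.strong_induction_on with
  | _ m ih =>
    rcases lt_or_ge m (M + 1) with hm | hm
    · have := Finset.single_le_sum (f := fun k => |relSeq q k|) (fun _ _ => abs_nonneg _)
        (Finset.mem_range.2 hm)
      linarith
    · have h1 := abs_relSeq_sub_one_le q hq.le m (by omega) ih
      have h2 := hM m (by omega)
      have h3 : |relSeq q m| ≤ |relSeq q m - 1| + 1 := by
        simpa using abs_add_le (relSeq q m - 1) 1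
      have h4 : B * (|q| ^ m + midSum |q| m) ≤ B * (1 / 2) :=
        mul_le_mul_of_nonneg_left h2 (by linarith)
      linarith

lemma tendsto_relSeq {q : ℝ} (hq : |q| < 1) :
    Filter.Tendsto (relSeq q) Filter.atTop (nhds 1) := by
  obtain ⟨B, hB⟩ := exists_abs_relSeq_le hq
  have h := (tendsto_pow_add_midSum (abs_nonneg q) hq).const_mul B
  rw [mul_zero] at h
  rw [tendsto_iff_norm_sub_tendsto_zero]
  refine squeeze_zero' (Filter.Eventually.of_forall fun _ => norm_nonneg _) ?_ h
  filter_upwards [Filter.eventually_ge_atTop 1] with m hm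
  exact abs_relSeq_sub_one_le q hq.le m hm fun k _ => hB k

lemma abs_splitSeq_sub_le (q : ℝ) {B : ℝ} (hB : ∀ k, |relSeq q k| ≤ B) (m : ℕ) (hm : 1 ≤ m) :
    |splitSeq q m - 2 * relSeq q m| ≤ B * B * midSum |q| m := by
  have h0 : relSeq q 0 = 1 := by rw [relSeq_eq, Finset.sum_range_zero, sub_zero]
  have : splitSeq q m - 2 * relSeq q m = ∑ k ∈ Finset.Ico 1 m, (m.choose k : ℝ) *
      (relSeq q k * relSeq q (m - k) * q ^ (k * (m - k))) := by
    rw [splitSeq, Finset.sum_range_succ, Finset.range_eq_Ico,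
      Finset.sum_eq_sum_Ico_succ_bot (by omega)]
    simp [h0]
    ring
  rw [this, midSum, Finset.mul_sum]
  refine (Finset.abs_sum_le_sum_abs _ _).trans (Finset.sum_le_sum fun k _ => ?_)
  rw [abs_mul, abs_mul, abs_mul, abs_pow, Nat.abs_cast, mul_left_comm]
  have h1 := hB k
  have h2 := hB (m - k)
  have hB0 := (abs_nonneg _).trans h1
  gcongr

lemma tendsto_splitSeq {q : ℝ} (hq : |q| < 1) :
    Filter.Tendsto (splitSeq q) Filter.atTop (nhds 2) := by
  obtain ⟨B, hB⟩ := exists_abs_relSeq_le hq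
  have h : Filter.Tendsto (fun m => splitSeq q m - 2 * relSeq q m) Filter.atTop (nhds 0) := by
    have h := (tendsto_midSum (abs_nonneg q) hq).const_mul (B * B)
    rw [mul_zero] at h
    rw [tendsto_zero_iff_norm_tendsto_zero]
    refine squeeze_zero' (Filter.Eventually.of_forall fun _ => norm_nonneg _) ?_ h
    filter_upwards [Filter.eventually_ge_atTop 1] with m hm
    exact abs_splitSeq_sub_le q hB m hm
  simpa using h.add ((tendsto_relSeq hq).const_mul 2)

/-- Between any two points of `(-1, 0)`, some necklace of cliques has a vanishing factor. -/
lemma exists_root {c d : ℝ} (hc : -1 < c) (hcd : c < d) (hd : d < 0) :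
    ∃ q ∈ Set.Ioo c d, ∃ m n : ℕ, 3 ≤ n ∧
      relSeq q (m + 1) + n * (q ^ (m + 1) * splitSeq q m) = 0 := by
  have hca : |c| < 1 := abs_lt.2 ⟨hc, by linarith⟩
  have hda : |d| < 1 := abs_lt.2 ⟨by linarith, by linarith⟩
  have hc0 : 0 < |c| := abs_pos.2 (by linarith)
  have hratio : |d| / |c| < 1 := by
    rw [div_lt_one hc0, abs_of_neg hd, abs_of_neg (hcd.trans hd)]
    linarith
  have shift : ∀ {f : ℕ → ℝ} {x : ℝ}, Filter.Tendsto f Filter.atTop (nhds x) →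
      Filter.Tendsto (fun m => f (m + 1)) Filter.atTop (nhds x) :=
    fun h => h.comp (Filter.tendsto_add_atTop_nat 1)
  have hsmall : Filter.Tendsto (fun m : ℕ => 6 * (|d| / |c|) ^ (m + 1) + 6 * |d| ^ (m + 1))
      Filter.atTop (nhds 0) := by
    have h1 := shift (tendsto_pow_atTop_nhds_zero_of_lt_one (by positivity) hratio)
    have h2 := shift (tendsto_pow_atTop_nhds_zero_of_lt_one (abs_nonneg d) hda)
    simpa using (h1.const_mul 6).add (h2.const_mul 6)
  have hev := ((shift (tendsto_relSeq hca)).eventually_lt_const (show (1 : ℝ) < 2 by norm_num)).and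
    (((shift (tendsto_relSeq hda)).eventually_const_lt (show (1 / 2 : ℝ) < 1 by norm_num)).and
    (((tendsto_splitSeq hca).eventually_const_lt (show (1 : ℝ) < 2 by norm_num)).and
    (((tendsto_splitSeq hda).eventually_lt_const (show (2 : ℝ) < 3 by norm_num)).and
    (hsmall.eventually_lt_const (show (0 : ℝ) < 1 / 2 by norm_num)))))
  obtain ⟨m, ⟨h1, h2, h3, h4, h5⟩, hm⟩ :=
    (hev.and_frequently Nat.frequently_even).exists
  have hodd : Odd (m + 1) := hm.add_one
  have hcp : c ^ (m + 1) = -|c| ^ (m + 1) := by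
    rw [abs_of_neg (hcd.trans hd), hodd.neg_pow, neg_neg]
  have hdp : d ^ (m + 1) = -|d| ^ (m + 1) := by
    rw [abs_of_neg hd, hodd.neg_pow, neg_neg]
  set C := |c| ^ (m + 1) with hC
  set D := |d| ^ (m + 1) with hD
  have hC0 : 0 < C := by positivity
  have hC1 : C ≤ 1 := pow_le_one₀ hc0.le hca.le
  have hD0 : 0 ≤ D := by positivity
  obtain ⟨n, hn, hn'⟩ : ∃ n : ℕ, 2 < n * C ∧ (n : ℝ) * C ≤ 2 + 2 * C := by
    refine ⟨⌈2 / C⌉₊ + 1, ?_, ?_⟩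
    · have := Nat.le_ceil (2 / C)
      rw [div_le_iff₀ hC0] at this
      push_cast
      nlinarith
    · have := (Nat.ceil_lt_add_one (show 0 ≤ 2 / C by positivity)).le
      have h : (⌈2 / C⌉₊ : ℝ) * C ≤ (2 / C + 1) * C := mul_le_mul_of_nonneg_right this hC0.le
      rw [add_mul, div_mul_cancel₀ _ hC0.ne'] at h
      push_cast
      nlinarith
  have hn3 : 3 ≤ n := by
    have : (2 : ℝ) < n := hn.trans_le (mul_le_of_le_one_right (by positivity) hC1)
    exact_mod_cast this
  have hnD : (n : ℝ) * D * 3 < 1 / 2 := by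
    refine lt_of_le_of_lt ?_ h5
    rw [div_pow, ← hC, ← hD]
    have : (n : ℝ) ≤ 2 / C + 2 := by
      rw [← div_le_div_iff_of_pos_right hC0] at hn'
      rw [mul_div_cancel_right₀ _ hC0.ne', add_div, mul_div_cancel_right₀ _ hC0.ne'] at hn'
      exact hn'
    calc (n : ℝ) * D * 3 ≤ (2 / C + 2) * D * 3 := by gcongr
      _ = 6 * (D / C) + 6 * D := by ring
  have hcont : Continuous fun q : ℝ =>
      relSeq q (m + 1) + n * (q ^ (m + 1) * splitSeq q m) := by
    have h1 := continuous_relSeq (m + 1)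
    have h2 := continuous_splitSeq m
    fun_prop
  obtain ⟨q, hq, hq0⟩ := intermediate_value_Ioo hcd.le hcont.continuousOn
    (show (0 : ℝ) ∈ Set.Ioo _ _ from ⟨by
      rw [hcp]
      nlinarith [mul_pos (show (0 : ℝ) < n * C by linarith) (sub_pos.2 h3)], by
      rw [hdp]
      nlinarith [mul_nonneg (show (0 : ℝ) ≤ n * D by positivity) (sub_pos.2 h4).le]⟩)
  exact ⟨q, hq, m, n, hn3, hq0⟩

end Asymptotics
section Necklace

variable {n m : ℕ}

/-- The vertices of a cyclic necklace of `n` cliques on `m + 2` vertices: cyclically arranged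
hubs, and `m` private vertices for each clique. -/
abbrev NecklaceVert (n m : ℕ) : Type := ZMod n ⊕ (ZMod n × Fin m)

/-- The vertex set of the `i`-th clique in the necklace. -/
def bead (i : ZMod n) : Finset (NecklaceVert n m) :=
  insert (.inl i) (insert (.inl (i + 1))
    (Finset.univ.map ⟨fun k : Fin m => .inr (i, k), fun _ _ h => by simpa using h⟩))

lemma inl_mem_bead {i j : ZMod n} :
    (.inl j : NecklaceVert n m) ∈ bead i ↔ j = i ∨ j = i + 1 := by
  simp [bead]

lemma inr_mem_bead {i j : ZMod n} {k : Fin m} :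
    (.inr (j, k) : NecklaceVert n m) ∈ bead i ↔ j = i := by
  simp only [bead, Finset.mem_insert, Finset.mem_map, Finset.mem_univ, true_and,
    reduceCtorEq, false_or]
  exact ⟨fun ⟨_, h⟩ => (Prod.mk.inj (Sum.inr.inj h)).1.symm, fun h => ⟨k, by rw [h]; rfl⟩⟩

lemma card_bead (hn : 3 ≤ n) (i : ZMod n) : #(bead i : Finset (NecklaceVert n m)) = m + 2 := by
  have : Fact (1 < n) := ⟨by omega⟩
  rw [bead, Finset.card_insert_of_notMem (by simp), Finset.card_insert_of_notMem (by simp),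
    Finset.card_map, Finset.card_univ, Fintype.card_fin]

lemma disjoint_pairs_bead (hn : 3 ≤ n) {i j : ZMod n} (hij : i ≠ j) :
    Disjoint (pairs (bead i : Finset (NecklaceVert n m))) (pairs (bead j)) := by
  have h2 : (1 + 1 : ZMod n) ≠ 0 := by
    have : ((2 : ℕ) : ZMod n) ≠ 0 := by
      rw [Ne, ZMod.natCast_eq_zero_iff]
      exact fun h => by have := Nat.le_of_dvd (by norm_num) h; omega
    rw [one_add_one_eq_two]
    exact_mod_cast this
  have hne : ∀ a : ZMod n, a ≠ a + 1 + 1 := fun a h => h2 (by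
    rw [add_assoc] at h
    exact left_eq_add.1 h)
  rw [Finset.disjoint_left]
  intro e
  induction e with | _ x y
  rw [mk_mem_pairs, mk_mem_pairs]
  rintro ⟨hxi, hyi, hxy⟩ ⟨hxj, hyj, -⟩
  rcases x with a | ⟨a, k⟩
  · rcases y with b | ⟨b, l⟩
    · rw [inl_mem_bead] at hxi hyi hxj hyj
      have hab : a ≠ b := fun h => hxy (by rw [h])
      rcases hxi with rfl | rfl <;> rcases hyi with rfl | rfl <;>
        rcases hxj with hx | hx <;> rcases hyj with hy | hy <;> grind
    · rw [inr_mem_bead] at hyi hyj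
      exact hij (hyi.symm.trans hyj)
  · rw [inr_mem_bead] at hxi hxj
    exact hij (hxi.symm.trans hxj)

variable {A : Finset (Sym2 (NecklaceVert n m))}

/-- Every vertex of `bead i` is joined to one of its two hubs within the bead. -/
def Covered (A : Finset (Sym2 (NecklaceVert n m))) (i : ZMod n) : Prop :=
  ∀ w ∈ bead i, EdgeJoined (A ∩ pairs (bead i)) (.inl i) w ∨
    EdgeJoined (A ∩ pairs (bead i)) (.inl (i + 1)) w

lemma linked_bead_iff {i : ZMod n} :
    Linked (A ∩ pairs (bead i)) (bead i) ↔
      Covered A i ∧ EdgeJoined (A ∩ pairs (bead i)) (.inl i) (.inl (i + 1)) := by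
  constructor
  · exact fun h => ⟨fun w hw => .inl (h _ (inl_mem_bead.2 (.inl rfl)) _ hw),
      h _ (inl_mem_bead.2 (.inl rfl)) _ (inl_mem_bead.2 (.inr rfl))⟩
  · rintro ⟨hc, h⟩ x hx y hy
    have key : ∀ z ∈ bead i, EdgeJoined (A ∩ pairs (bead i)) (.inl i) z := fun z hz =>
      (hc z hz).elim id h.trans
    exact (key x hx).symm.trans (key y hy)

lemma splits_bead_iff {i : ZMod n} :
    Splits (A ∩ pairs (bead i)) (bead i) (.inl i) (.inl (i + 1)) ↔
      Covered A i ∧ ¬ EdgeJoined (A ∩ pairs (bead i)) (.inl i) (.inl (i + 1)) :=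
  and_comm

variable [NeZero n]

/-- The edges of the necklace. -/
def necklaceEdges (n m : ℕ) [NeZero n] : Finset (Sym2 (NecklaceVert n m)) :=
  Finset.univ.biUnion fun i => pairs (bead i)

lemma edgeFin_necklace :
    edgeFin (SimpleGraph.fromEdgeSet (necklaceEdges n m : Set (Sym2 (NecklaceVert n m)))) =
      necklaceEdges n m := by
  ext e
  rw [edgeFin, Set.Finite.mem_toFinset, SimpleGraph.edgeSet_fromEdgeSet]
  induction e with | _ x y
  simp only [necklaceEdges, Finset.coe_biUnion, Set.mem_sdiff, Set.mem_iUnion, Finset.mem_coe,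
    Finset.mem_biUnion, mk_mem_pairs, Sym2.mem_diagSet, Sym2.mk_isDiag_iff]
  grind

lemma exists_mem_pairs_bead (hA : A ⊆ necklaceEdges n m) {x y : NecklaceVert n m}
    (h : s(x, y) ∈ A) : ∃ i, s(x, y) ∈ A ∩ pairs (bead i) := by
  obtain ⟨i, -, hi⟩ := Finset.mem_biUnion.1 (hA h)
  exact ⟨i, Finset.mem_inter.2 ⟨h, hi⟩⟩

lemma covered_of_joined (hA : A ⊆ necklaceEdges n m) (h : ∀ x y, EdgeJoined A x y) (i : ZMod n) :
    Covered A i := by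
  intro w hw
  by_contra! hcon
  refine hcon.1 (EdgeJoined.symm ?_)
  refine ((h w (.inl i)).induction
    (P := fun x => x ∈ bead i ∧ EdgeJoined (A ∩ pairs (bead i)) w x) ⟨hw, .refl w⟩ ?_).2
  rintro a b - ⟨ha, hwa⟩ hab
  obtain ⟨j, hj⟩ := exists_mem_pairs_bead hA hab
  suffices j = i by
    subst this
    exact ⟨(mk_mem_pairs.1 (Finset.mem_inter.1 hj).2).2.1, hwa.trans (.of_mem hj)⟩
  have haj := (mk_mem_pairs.1 (Finset.mem_inter.1 hj).2).1
  rcases a with a | ⟨a, k⟩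
  · rcases inl_mem_bead.1 ha with rfl | rfl
    · exact (hcon.1 hwa.symm).elim
    · exact (hcon.2 hwa.symm).elim
  · exact (inr_mem_bead.1 haj).symm.trans (inr_mem_bead.1 ha)

lemma linked_or_linked_of_joined (hA : A ⊆ necklaceEdges n m) (h : ∀ x y, EdgeJoined A x y)
    {i j : ZMod n} (hij : i ≠ j) :
    Linked (A ∩ pairs (bead i)) (bead i) ∨ Linked (A ∩ pairs (bead j)) (bead j) := by
  classical
  have hc := covered_of_joined hA h
  have hub : ∀ x : NecklaceVert n m, ∃ a : ZMod n, (∀ b, x = .inl b → a = b) ∧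
      ∀ k, x ∈ bead k → (a = k ∨ a = k + 1) ∧ EdgeJoined (A ∩ pairs (bead k)) (.inl a) x := by
    rintro (b | ⟨k, l⟩)
    · refine ⟨b, fun c hc => Sum.inl_injective hc, fun k hk => ⟨inl_mem_bead.1 hk, .refl _⟩⟩
    · rcases hc k (.inr (k, l)) (inr_mem_bead.2 rfl) with h | h
      · refine ⟨k, fun _ h => (nomatch h), fun k' hk => ?_⟩
        obtain rfl := inr_mem_bead.1 hk
        exact ⟨.inl rfl, h⟩
      · refine ⟨k + 1, fun _ h => (nomatch h), fun k' hk => ?_⟩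
        obtain rfl := inr_mem_bead.1 hk
        exact ⟨.inr rfl, h⟩
  choose f hf hf' using hub
  let T : Finset (ZMod n) := {k | Linked (A ∩ pairs (bead k)) (bead k)}
  let B : Finset (Sym2 (ZMod n)) := T.image fun k => s(k, k + 1)
  have hB : ∀ x y, EdgeJoined B (f x) (f y) := by
    intro x y
    refine (h x y).induction (P := fun y => EdgeJoined B (f x) (f y)) (.refl _) ?_
    intro a b _ ha hab
    obtain ⟨k, hk⟩ := exists_mem_pairs_bead hA hab
    obtain ⟨hak, hbk, -⟩ := mk_mem_pairs.1 (Finset.mem_inter.1 hk).2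
    obtain ⟨ha1, ha2⟩ := hf' a k hak
    obtain ⟨hb1, hb2⟩ := hf' b k hbk
    refine ha.trans ?_
    have hj := (ha2.trans (.of_mem hk)).trans hb2.symm
    have hT : EdgeJoined (A ∩ pairs (bead k)) (.inl k) (.inl (k + 1)) →
        EdgeJoined B k (k + 1) := fun hkk =>
      .of_mem (Finset.mem_image.2 ⟨k, by simpa [T] using linked_bead_iff.2 ⟨hc k, hkk⟩, rfl⟩)
    rcases ha1 with ha1 | ha1 <;> rcases hb1 with hb1 | hb1 <;> rw [ha1, hb1] at hj ⊢
    · exact .refl _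
    · exact hT hj
    · exact (hT hj.symm).symm
    · exact .refl _
  have hconn : (SimpleGraph.fromEdgeSet (B : Set (Sym2 (ZMod n)))).Connected := by
    refine ⟨fun a b => ?_⟩
    have := hB (.inl a) (.inl b)
    rwa [hf _ a rfl, hf _ b rfl] at this
  have hcard := hconn.card_vert_le_card_edgeSet_add_one
  have hE : Nat.card (SimpleGraph.fromEdgeSet (B : Set (Sym2 (ZMod n)))).edgeSet ≤ #T := by
    rw [Nat.card_coe_set_eq, SimpleGraph.edgeSet_fromEdgeSet]
    refine (Set.ncard_le_ncard Set.sdiff_subset).trans ?_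
    rw [Set.ncard_coe_finset]
    exact Finset.card_image_le
  by_contra! hcon
  have hT : T ⊆ ({i, j} : Finset (ZMod n))ᶜ := by
    intro k hk
    simp only [T, Finset.mem_filter, Finset.mem_univ, true_and] at hk
    simp only [Finset.mem_compl, Finset.mem_insert, Finset.mem_singleton]
    rintro (rfl | rfl)
    · exact hcon.1 hk
    · exact hcon.2 hk
  have h1 := Finset.card_le_card hT
  have h2 := Finset.card_le_univ ({i, j} : Finset (ZMod n))
  rw [Finset.card_compl, Finset.card_pair hij] at h1
  rw [Finset.card_pair hij] at h2
  rw [Nat.card_eq_fintype_card] at hcard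
  omega

lemma joined_of_linked (hc : ∀ i, Covered A i) (j : ZMod n)
    (hj : ∀ i ≠ j, Linked (A ∩ pairs (bead i)) (bead i)) (x y : NecklaceVert n m) :
    EdgeJoined A x y := by
  have hub : ∀ t < n, EdgeJoined A (.inl (j + 1)) (.inl (j + 1 + (t : ZMod n))) := by
    intro t
    induction t with
    | zero => simp [EdgeJoined.refl]
    | succ t ih =>
      intro ht
      refine (ih (by omega)).trans ?_
      have hne : j + 1 + (t : ZMod n) ≠ j := by
        rw [add_assoc, Ne, add_eq_left]
        intro h
        have : ((t + 1 : ℕ) : ZMod n) = 0 := by push_cast; rw [add_comm]; exact h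
        rw [ZMod.natCast_eq_zero_iff] at this
        exact absurd (Nat.le_of_dvd (by omega) this) (by omega)
      have := (linked_bead_iff.1 (hj _ hne)).2.mono Finset.inter_subset_left
      rw [Nat.cast_succ, ← add_assoc]
      exact this
  have hub' : ∀ i, EdgeJoined A (.inl (j + 1)) (.inl i) := by
    intro i
    have := hub (i - (j + 1)).val (ZMod.val_lt _)
    rwa [ZMod.natCast_rightInverse, add_sub_cancel] at this
  have key : ∀ x, EdgeJoined A (.inl (j + 1)) x := by
    rintro (i | ⟨i, k⟩)
    · exact hub' i
    · rcases hc i (.inr (i, k)) (inr_mem_bead.2 rfl) with h | h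
      · exact (hub' i).trans (h.mono Finset.inter_subset_left)
      · exact (hub' (i + 1)).trans (h.mono Finset.inter_subset_left)
  exact (key x).symm.trans (key y)

lemma ind_connected_necklace (hA : A ⊆ necklaceEdges n m) :
    ind (SimpleGraph.fromEdgeSet (A : Set (Sym2 (NecklaceVert n m)))).Connected =
      (∏ i, ind (Linked (A ∩ pairs (bead i)) (bead i))) +
      ∑ j, ∏ i, if i = j then ind (Splits (A ∩ pairs (bead i)) (bead i) (.inl i) (.inl (i + 1)))
        else ind (Linked (A ∩ pairs (bead i)) (bead i)) := by
  have hprod : ∀ j : ZMod n, (∏ i, if i = j then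
      ind (Splits (A ∩ pairs (bead i)) (bead i) (.inl i) (.inl (i + 1)))
        else ind (Linked (A ∩ pairs (bead i)) (bead i))) =
      ind (Splits (A ∩ pairs (bead j)) (bead j) (.inl j) (.inl (j + 1)) ∧
        ∀ i ≠ j, Linked (A ∩ pairs (bead i)) (bead i)) := by
    intro j
    rw [← Finset.mul_prod_erase _ _ (Finset.mem_univ j), if_pos rfl, ind_and]
    congr 1
    rw [Finset.prod_congr rfl fun i hi => if_neg (Finset.ne_of_mem_erase hi), prod_ind]
    exact ind_congr (by simp)
  simp only [hprod]
  rw [prod_ind]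
  by_cases hconn : (SimpleGraph.fromEdgeSet (A : Set (Sym2 (NecklaceVert n m)))).Connected
  · have hJ : ∀ x y, EdgeJoined A x y := fun x y => hconn.preconnected x y
    have hc := covered_of_joined hA hJ
    rw [ind_true hconn]
    by_cases hall : ∀ i, Linked (A ∩ pairs (bead i)) (bead i)
    · rw [ind_true fun i _ => hall i, Finset.sum_eq_zero, add_zero]
      intro j _
      exact ind_false fun h => (splits_bead_iff.1 h.1).2 (linked_bead_iff.1 (hall j)).2
    · rw [ind_false fun h => hall fun i => h i (Finset.mem_univ i)]
      obtain ⟨j, hj⟩ := not_forall.1 hall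
      rw [Finset.sum_eq_single j, zero_add, ind_true]
      · exact ⟨splits_bead_iff.2 ⟨hc j, fun h => hj (linked_bead_iff.2 ⟨hc j, h⟩)⟩,
          fun i hi => (linked_or_linked_of_joined hA hJ hi).resolve_right hj⟩
      · exact fun k _ hk => ind_false fun h => hj (h.2 j hk.symm)
      · simp
  · have hJ : ¬ ∀ x y, EdgeJoined A x y := fun h => hconn
      { preconnected := h, nonempty := ⟨.inl 0⟩ }
    rw [ind_false hconn, ind_false, Finset.sum_eq_zero, add_zero]
    · intro j _
      refine ind_false fun ⟨h1, h2⟩ => hJ (joined_of_linked (fun i => ?_) j h2)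
      by_cases hij : i = j
      · subst hij
        exact (splits_bead_iff.1 h1).1
      · exact (linked_bead_iff.1 (h2 i hij)).1
    · exact fun h => hJ (joined_of_linked (fun i => (linked_bead_iff.1 (h i (Finset.mem_univ i))).1)
        0 fun i _ => h i (Finset.mem_univ i))

lemma wsum_necklace (hn : 3 ≤ n) (q : ℝ) (f : ZMod n → Finset (Sym2 (NecklaceVert n m)) → ℝ) :
    wsum q (necklaceEdges n m) (fun A => ∏ i, f i (A ∩ pairs (bead i))) =
      ∏ i, wsum q (pairs (bead i)) (f i) :=
  wsum_biUnion q Finset.univ _ (fun _ _ _ _ => disjoint_pairs_bead hn) f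

lemma relPoly_necklace (hn : 3 ≤ n) (q : ℝ) :
    relPoly (SimpleGraph.fromEdgeSet (necklaceEdges n m : Set (Sym2 (NecklaceVert n m)))) q =
      relSeq q (m + 1) ^ (n - 1) *
        (relSeq q (m + 1) + n * (q ^ (m + 1) * splitSeq q m)) := by
  have : Fact (1 < n) := ⟨by omega⟩
  have hR : ∀ i : ZMod n, wsum q (pairs (bead i : Finset (NecklaceVert n m)))
      (fun A => ind (Linked A (bead i))) = relSeq q (m + 1) := fun i =>
    cliqueRel_eq q (m + 1) _ (card_bead hn i)
  have hS : ∀ i : ZMod n, wsum q (pairs (bead i : Finset (NecklaceVert n m)))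
      (fun A => ind (Splits A (bead i) (.inl i) (.inl (i + 1)))) = q ^ (m + 1) * splitSeq q m :=
    fun i => cliqueSplit_eq q m _ (card_bead hn i) (inl_mem_bead.2 (.inl rfl))
      (inl_mem_bead.2 (.inr rfl)) (by simp)
  have h0 : relPoly (SimpleGraph.fromEdgeSet
      (necklaceEdges n m : Set (Sym2 (NecklaceVert n m)))) q =
      wsum q (necklaceEdges n m) fun A =>
        ind (SimpleGraph.fromEdgeSet (A : Set (Sym2 (NecklaceVert n m)))).Connected := by
    rw [relPoly, edgeFin_necklace, wsum]
    refine Finset.sum_congr rfl fun A _ => ?_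
    rw [ind, wt]
    split_ifs <;> simp
  rw [h0, wsum_congr q fun A hA => ind_connected_necklace hA, wsum_add, wsum_sum,
    wsum_necklace hn q fun i A => ind (Linked A (bead i)), Finset.prod_congr rfl fun i _ => hR i,
    Finset.prod_const, Finset.card_univ, ZMod.card]
  have hterm : ∀ j : ZMod n, wsum q (necklaceEdges n m) (fun A => ∏ i, if i = j then
      ind (Splits (A ∩ pairs (bead i)) (bead i) (.inl i) (.inl (i + 1)))
        else ind (Linked (A ∩ pairs (bead i)) (bead i))) =
      q ^ (m + 1) * splitSeq q m * relSeq q (m + 1) ^ (n - 1) := by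
    intro j
    rw [wsum_necklace hn q fun i A => if i = j then ind (Splits A (bead i) (.inl i) (.inl (i + 1)))
      else ind (Linked A (bead i)), ← Finset.mul_prod_erase _ _ (Finset.mem_univ j)]
    congr 1
    · simp only [if_true, hS]
    · rw [Finset.prod_congr rfl fun i hi => show _ = relSeq q (m + 1) by
        simp only [if_neg (Finset.ne_of_mem_erase hi), hR], Finset.prod_const,
        Finset.card_erase_of_mem (Finset.mem_univ j), Finset.card_univ, ZMod.card]
  rw [Finset.sum_congr rfl fun j _ => hterm j, Finset.sum_const, Finset.card_univ, ZMod.card,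
    nsmul_eq_mul]
  obtain ⟨k, rfl⟩ := Nat.exists_eq_add_of_le' (show 1 ≤ n by omega)
  rw [Nat.add_sub_cancel]
  ring

lemma connected_necklace :
    (SimpleGraph.fromEdgeSet (necklaceEdges n m : Set (Sym2 (NecklaceVert n m)))).Connected := by
  have hL : ∀ i : ZMod n, Linked (necklaceEdges n m ∩ pairs (bead i)) (bead i) := by
    intro i x hx y hy
    by_cases hxy : x = y
    · rw [hxy]
      exact .refl y
    · have h := mk_mem_pairs.2 ⟨hx, hy, hxy⟩
      exact .of_mem (Finset.mem_inter.2
        ⟨Finset.mem_biUnion.2 ⟨i, Finset.mem_univ i, h⟩, h⟩)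
  exact
    { preconnected := joined_of_linked (fun i => (linked_bead_iff.1 (hL i)).1) 0 fun i _ => hL i
      nonempty := ⟨.inl 0⟩ }

end Necklace

/-- Every nonempty open interval contained in `(-1, 0)` contains a real reliability root of a
finite connected simple graph. -/
theorem reliability_root_in_interval (a b : ℝ) (ha : -1 ≤ a) (hab : a < b) (hb : b ≤ 0) :
    ∃ q₀ ∈ Set.Ioo a b, ∃ (V : Type) (_ : Finite V) (G : SimpleGraph V),
      G.Connected ∧ relPoly G q₀ = 0 := by
  obtain ⟨c, hac, hcb⟩ := exists_between hab
  obtain ⟨d, hcd, hdb⟩ := exists_between hcb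
  obtain ⟨q, hq, m, n, hn, h0⟩ := exists_root (ha.trans_lt hac) hcd (hdb.trans_le hb)
  have : NeZero n := ⟨by omega⟩
  refine ⟨q, ⟨hac.trans hq.1, hq.2.trans hdb⟩, NecklaceVert n m, inferInstance,
    SimpleGraph.fromEdgeSet (necklaceEdges n m : Set (Sym2 (NecklaceVert n m))),
    connected_necklace, ?_⟩
  rw [relPoly_necklace hn, h0, mul_zero]

end
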